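/- Let n ≥ 2 and let (x,ξ) ∈ Uℝⁿ₁ with x = (x₀,x₁), ξ = (ξ₀,ξ₁) ∈ ℝ^{n−1}×ℝ, and let σ(x,ξ) = (x',ξ') with x' = (−x₁/ξ₁, x₀ − (x₁/ξ₁)ξ₀) and ξ' = (1/ξ₁, ξ₀/ξ₁). If ⟨x,ξ⟩ = λ (i.e. (x,ξ) lies on the oriented space-like hyperplane P(ξ,λ) of ℝⁿ₁), then x'·ξ' = λ/ξ₁; that is, σ maps the hyperplane P(ξ,λ) in Uℝⁿ₁ into the hyperplane P(ξ', λ/ξ₁) in Uℝⁿ. -/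

import Mathlib

noncomputable section

/-- if `(x,ξ) ∈ Uℝⁿ₁` (so `|ξ₀|² - ξ₁² = -1`) lies on the space-like
hyperplane `P(ξ,λ)` of `ℝⁿ₁` (i.e. `⟨x,ξ⟩ = λ`), then the image
`σ(x,ξ) = (x',ξ')` with `x' = (-x₁/ξ₁, x₀ - (x₁/ξ₁)ξ₀)` and `ξ' = (1/ξ₁, ξ₀/ξ₁)`
satisfies `x'·ξ' = λ/ξ₁`, i.e. `σ(x,ξ)` lies on the hyperplane `P(ξ',λ/ξ₁)` of
`Uℝⁿ`. -/
theorem stmt16 (n : ℕ) (hn : 2 ≤ n) (x₀ ξ₀ : Fin (n - 1) → ℝ) (x₁ ξ₁ lam : ℝ)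
    (hξ : (∑ i, ξ₀ i ^ 2) - ξ₁ ^ 2 = -1)
    (hplane : (∑ i, x₀ i * ξ₀ i) - x₁ * ξ₁ = lam) :
    (-x₁ / ξ₁) * (1 / ξ₁)
        + (∑ i, (x₀ i - (x₁ / ξ₁) * ξ₀ i) * (ξ₀ i / ξ₁)) = lam / ξ₁ := by
  have hne : ξ₁ ≠ 0 := by
    rintro rfl
    have : 0 ≤ ∑ i, ξ₀ i ^ 2 := Finset.sum_nonneg fun i _ => sq_nonneg _
    linarith
  have hsum : (∑ i, (x₀ i - (x₁ / ξ₁) * ξ₀ i) * (ξ₀ i / ξ₁))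
      = (∑ i, x₀ i * ξ₀ i) / ξ₁ - x₁ / ξ₁ ^ 2 * ∑ i, ξ₀ i ^ 2 := by
    rw [Finset.sum_div, Finset.mul_sum, ← Finset.sum_sub_distrib]
    refine Finset.sum_congr rfl fun i _ => ?_
    field_simp
  have hsq : (∑ i, ξ₀ i ^ 2) = ξ₁ ^ 2 - 1 := by linarith
  rw [hsum, hsq, ← hplane]
  field_simp
  ring
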